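/- arXiv:math/0312363 — 2 statements merged into one kernel-verified Lean document; each statement's English description precedes it below -/
import Mathlib

section
/- For every θ with 0 < θ < π and every real x, one has f_θ(x) − f_θ(−x) = 2·arctan( tan((π−θ)/2)·tanh(x/2) ). -/
/-- `f θ x = −arg(1 − e^{x+iθ})`, the circle pattern angle function. -/
noncomputable def f (θ x : ℝ) : ℝ := -(1 - Complex.exp (x + θ * Complex.I)).arg

theorem f_explicit (θ : ℝ) (hθ0 : 0 < θ) (hθπ : θ < Real.pi) (x : ℝ) :
    f θ x = Real.pi / 2 - θ / 2 +
      Real.arctan (Real.tan ((Real.pi - θ) / 2) * Real.tanh (x / 2)) := by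
  have hs : 0 < Real.sin (θ / 2) := Real.sin_pos_of_pos_of_lt_pi (by linarith) (by linarith)
  have hH : 0 < Real.cosh (x / 2) := Real.cosh_pos _
  set t := Real.tan ((Real.pi - θ) / 2) * Real.tanh (x / 2) with ht
  have ht2 : t = Real.cos (θ / 2) / Real.sin (θ / 2) *
      (Real.sinh (x / 2) / Real.cosh (x / 2)) := by
    rw [ht, Real.tanh_eq_sinh_div_cosh, Real.tan_eq_sin_div_cos,
      show (Real.pi - θ) / 2 = Real.pi / 2 - θ / 2 by ring,
      Real.sin_pi_div_two_sub, Real.cos_pi_div_two_sub]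
  set a := Real.arctan t with ha
  have h1 : -(Real.pi / 2) < a := Real.neg_pi_div_two_lt_arctan t
  have h2 : a < Real.pi / 2 := Real.arctan_lt_pi_div_two t
  have hC : 0 < Real.cos a := Real.cos_arctan_pos t
  have hS : Real.sin a = t * Real.cos a := by
    have := Real.tan_arctan t
    rw [← ha, Real.tan_eq_sin_div_cos] at this
    field_simp at this
    linarith
  have hE : 0 < Real.exp (x / 2) := Real.exp_pos _
  have hE2 : Real.exp x = Real.exp (x / 2) ^ 2 := by
    rw [← Real.exp_nat_mul]; congr 1; push_cast; ring
  have hEF : Real.exp (x / 2) * Real.exp (-(x / 2)) = 1 := by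
    rw [← Real.exp_add]; simp
  have hc1 := Real.sin_sq_add_cos_sq (θ / 2)
  have hcos : Real.cos θ = Real.cos (θ / 2) ^ 2 - Real.sin (θ / 2) ^ 2 := by
    rw [← Real.cos_two_mul']; congr 1; ring
  have hsin : Real.sin θ = 2 * Real.sin (θ / 2) * Real.cos (θ / 2) := by
    rw [← Real.sin_two_mul]; congr 1; ring
  have key1 : Real.sin (θ / 2) * Real.cosh (x / 2) * t
      = Real.cos (θ / 2) * Real.sinh (x / 2) := by
    rw [ht2]; field_simp
  set r := 2 * Real.exp (x / 2) * Real.cosh (x / 2) * Real.sin (θ / 2) / Real.cos a with hr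
  have hrpos : 0 < r := by positivity
  have hrC : r * Real.cos a = 2 * Real.exp (x / 2) * Real.cosh (x / 2) * Real.sin (θ / 2) := by
    rw [hr]; field_simp
  have hrS : r * Real.sin a = 2 * Real.exp (x / 2) * (Real.cos (θ / 2) * Real.sinh (x / 2)) := by
    rw [hS, ← key1]; linear_combination t * hrC
  have e1 : Real.cos (θ / 2 - Real.pi / 2 - a) = Real.sin (θ / 2 - a) := by
    rw [show θ / 2 - Real.pi / 2 - a = (θ / 2 - a) - Real.pi / 2 by ring, Real.cos_sub_pi_div_two]
  have e2 : Real.sin (θ / 2 - Real.pi / 2 - a) = -Real.cos (θ / 2 - a) := by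
    rw [show θ / 2 - Real.pi / 2 - a = (θ / 2 - a) - Real.pi / 2 by ring, Real.sin_sub_pi_div_two]
  have re1 : 1 - Real.exp x * Real.cos θ = r * Real.cos (θ / 2 - Real.pi / 2 - a) := by
    rw [e1, Real.sin_sub, hE2, hcos]
    rw [Real.cosh_eq] at hrC
    rw [Real.sinh_eq] at hrS
    linear_combination -hc1 - Real.sin (θ / 2) * hrC + Real.cos (θ / 2) * hrS
      - (Real.sin (θ / 2) ^ 2 + Real.cos (θ / 2) ^ 2) * hEF
  have im1 : - (Real.exp x * Real.sin θ) = r * Real.sin (θ / 2 - Real.pi / 2 - a) := by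
    rw [e2, Real.cos_sub, hE2, hsin]
    rw [Real.cosh_eq] at hrC
    rw [Real.sinh_eq] at hrS
    linear_combination Real.cos (θ / 2) * hrC + Real.sin (θ / 2) * hrS
  have main : 1 - Complex.exp (x + θ * Complex.I)
      = (r : ℂ) * (Complex.cos ((θ / 2 - Real.pi / 2 - a : ℝ) : ℂ)
        + Complex.sin ((θ / 2 - Real.pi / 2 - a : ℝ) : ℂ) * Complex.I) := by
    rw [← Complex.ofReal_cos, ← Complex.ofReal_sin, mul_add, ← mul_assoc, ← Complex.ofReal_mul,
      ← Complex.ofReal_mul, ← re1, ← im1, Complex.exp_add, Complex.exp_mul_I]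
    push_cast
    ring
  rw [f, main, Complex.arg_mul_cos_add_sin_mul_I hrpos ⟨by linarith, by linarith⟩]
  ring

/-- For `0 < θ < π`, `f θ x − f θ (−x) = 2 arctan (tan ((π−θ)/2) · tanh (x/2))`. -/
theorem fTheta_odd_part (θ : ℝ) (hθ0 : 0 < θ) (hθπ : θ < Real.pi) (x : ℝ) :
    f θ x - f θ (-x) =
      2 * Real.arctan (Real.tan ((Real.pi - θ) / 2) * Real.tanh (x / 2)) := by
  rw [f_explicit θ hθ0 hθπ, f_explicit θ hθ0 hθπ, neg_div, Real.tanh_neg, mul_neg,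
    Real.arctan_neg]
  ring
end

section
/- Let α and β satisfy 0 < α ≤ β < π/2. Then the hyperbolic volume of the triply orthogonal hyperbolic tetrahedron with one vertex at infinity and non-right dihedral angles α, π/2 − α, β, computed in the upper half-space model, equals the following explicit integral, and one has ∫∫_{{(x,y) : 0 < x < cos β, 0 < y < x·tan α}} 1/(2(1 − x² − y²)) dy dx = (1/8)·( 2·Cl(π − 2α) + Cl(2α − 2β) + Cl(2α + 2β) ). -/
open MeasureTheory

/-- Clausen's integral, defined by its convergent Fourier series
`Cl x = ∑_{n=1}^∞ sin (n x) / n²`. -/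
noncomputable def Cl (x : ℝ) : ℝ := ∑' n : ℕ, Real.sin (((n : ℝ) + 1) * x) / ((n : ℝ) + 1) ^ 2

open Real Filter Topology

lemma nsq (r t : ℝ) : ‖1 - (r:ℂ) * Complex.exp ((2*t:ℝ) * Complex.I)‖^2 = (1-r)^2 + 4*r*(sin t)^2 := by
  rw [← Complex.normSq_eq_norm_sq, Complex.normSq_apply]
  simp [Complex.exp_ofReal_mul_I_re, Complex.exp_ofReal_mul_I_im, -Complex.ofReal_mul]
  have h1 := Real.cos_two_mul t
  have h2 := Real.sin_sq_add_cos_sq (2*t)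
  have h3 := Real.sin_sq_add_cos_sq t
  linear_combination r^2 * h2 - 2 * r * h1 - 4*r*h3

lemma logid (r t : ℝ) : log ‖1 - (r:ℂ) * Complex.exp ((2*t:ℝ) * Complex.I)‖ = 1/2 * log ((1-r)^2 + 4*r*(sin t)^2) := by
  rw [← nsq, Real.log_pow]; push_cast; ring

lemma cosSeries (r t : ℝ) (h0 : 0 ≤ r) (h1 : r < 1) :
    HasSum (fun n : ℕ => r^(n+1) / ((n:ℝ)+1) * cos (((n:ℝ)+1) * (2*t)))
      (-(1/2) * log ((1-r)^2 + 4*r*(sin t)^2)) := by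
  have hz : ‖(r:ℂ) * Complex.exp ((2*t:ℝ) * Complex.I)‖ < 1 := by
    rw [norm_mul, Complex.norm_exp_ofReal_mul_I]; simpa [abs_of_nonneg h0] using h1
  have h := Complex.hasSum_re (Complex.hasSum_taylorSeries_neg_log hz)
  rw [Complex.neg_re, Complex.log_re, logid] at h
  rw [← hasSum_nat_add_iff' 1] at h
  have e1 : -(1/2 * log ((1-r)^2 + 4*r*(sin t)^2)) - ∑ i ∈ Finset.range 1, ((((r:ℂ) * Complex.exp ((2*t:ℝ) * Complex.I)) ^ i / (i:ℂ)).re) = -(1/2) * log ((1-r)^2 + 4*r*(sin t)^2) := by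
    rw [Finset.sum_range_one, Nat.cast_zero, div_zero, Complex.zero_re]; ring
  rw [e1] at h
  rw [show (fun n : ℕ => r^(n+1) / ((n:ℝ)+1) * cos (((n:ℝ)+1) * (2*t))) = (fun n : ℕ => (((r:ℂ) * Complex.exp ((2*t:ℝ) * Complex.I)) ^ (n+1) / ((n+1:ℕ):ℂ)).re) from ?_]
  · exact h
  funext n
  rw [mul_pow, ← Complex.exp_nat_mul, ← Complex.ofReal_pow]
  have : ((n+1:ℕ):ℂ) * ((2*t:ℝ) * Complex.I) = ((((n:ℝ)+1) * (2*t) : ℝ):ℂ) * Complex.I := by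
    push_cast; ring
  rw [this, mul_div_assoc, Complex.re_ofReal_mul]
  have : ((n+1:ℕ):ℂ) = (((n:ℝ)+1 : ℝ):ℂ) := by push_cast; ring
  rw [this, Complex.div_ofReal_re, Complex.exp_ofReal_mul_I_re]
  ring

lemma cosInt (n : ℕ) (r a b : ℝ) : ∫ t in a..b, r^(n+1) / ((n:ℝ)+1) * cos (((n:ℝ)+1) * (2*t))
   = r^(n+1) * (1/2) * (sin (((n:ℝ)+1) * (2*b)) / ((n:ℝ)+1)^2 - sin (((n:ℝ)+1) * (2*a)) / ((n:ℝ)+1)^2) := by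
  have hn : ((n:ℝ)+1) ≠ 0 := by positivity
  rw [intervalIntegral.integral_eq_sub_of_hasDerivAt (f := fun t => r^(n+1) * (1/2) * (sin (((n:ℝ)+1) * (2*t)) / ((n:ℝ)+1)^2))]
  · ring
  · intro x _
    have h := (((((hasDerivAt_id x).const_mul 2).const_mul ((n:ℝ)+1)).sin.div_const (((n:ℝ)+1)^2)).const_mul (r^(n+1) * (1/2)))
    refine h.congr_deriv ?_
    simp only [id]
    field_simp
  · apply Continuous.intervalIntegrable; fun_prop

lemma sumCl (x : ℝ) : Summable (fun n : ℕ => Real.sin (((n : ℝ) + 1) * x) / ((n : ℝ) + 1) ^ 2) := by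
  have hs : Summable (fun n : ℕ => 1 / ((n : ℝ) + 1) ^ 2) := by
    have := (summable_nat_add_iff 1).2 (Real.summable_one_div_nat_pow.2 (one_lt_two))
    simpa using this
  apply Summable.of_norm_bounded hs
  intro n
  rw [norm_div, norm_of_nonneg (by positivity : (0:ℝ) ≤ ((n : ℝ) + 1) ^ 2)]
  gcongr
  exact abs_sin_le_one _

lemma intR (r a b : ℝ) (h0 : 0 ≤ r) (h1 : r < 1) :
    ∫ t in a..b, -(1/2) * log ((1-r)^2 + 4*r*(sin t)^2) =
     ∑' n : ℕ, r^(n+1) * ((1/2) * (sin (((n:ℝ)+1) * (2*b)) / ((n:ℝ)+1)^2 - sin (((n:ℝ)+1) * (2*a)) / ((n:ℝ)+1)^2)) := by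
  have hsum := intervalIntegral.hasSum_intervalIntegral_of_summable_norm (a := a) (b := b)
    (f := fun n : ℕ => (⟨fun t : ℝ => r^(n+1) / ((n:ℝ)+1) * cos (((n:ℝ)+1) * (2*t)), by fun_prop⟩ : C(ℝ, ℝ))) ?_
  · simp only [ContinuousMap.coe_mk] at hsum
    rw [intervalIntegral.integral_congr (g := fun t => ∑' n : ℕ, r^(n+1) / ((n:ℝ)+1) * cos (((n:ℝ)+1) * (2*t))) (fun t _ => (cosSeries r t h0 h1).tsum_eq.symm)]
    rw [← hsum.tsum_eq]
    congr 1; ext n; rw [cosInt]; ring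
  · refine Summable.of_nonneg_of_le (fun _ => norm_nonneg _) (fun n => ?_) (summable_geometric_of_lt_one h0 h1)
    refine (ContinuousMap.norm_le _ (by positivity)).2 ?_
    intro x
    simp only [ContinuousMap.restrict_apply, ContinuousMap.coe_mk]
    rw [norm_mul, norm_of_nonneg (by positivity : 0 ≤ r^(n+1) / ((n:ℝ)+1))]
    have : r^(n+1)/((n:ℝ)+1) ≤ r^n := by
      rw [div_le_iff₀ (by positivity), pow_succ]
      have : 0 ≤ r^n := by positivity
      nlinarith [mul_nonneg this (Nat.cast_nonneg (α := ℝ) n)]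
    calc _ ≤ r^n * 1 := by
          gcongr
          exact abs_cos_le_one _
      _ = _ := mul_one _

lemma keyLem (a b : ℝ) (ha : 0 ≤ a) (hab : a ≤ b) (hb : b < π) :
    IntervalIntegrable (fun t => log (2 * sin t)) volume a b ∧
    ∫ t in a..b, log (2 * sin t) = (1/2) * (Cl (2*a) - Cl (2*b)) := by
  have hsin : ∀ t ∈ Set.uIoc a b, 0 < sin t := by
    intro t ht
    rw [Set.uIoc_of_le hab] at ht
    exact sin_pos_of_pos_of_lt_pi (lt_of_le_of_lt ha ht.1) (lt_of_le_of_lt ht.2 hb)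
  have hint0 : IntervalIntegrable (fun t => log (sin t)) volume a b := intervalIntegrable_log_sin
  have hint : IntervalIntegrable (fun t => log (2 * sin t)) volume a b := by
    refine ((intervalIntegrable_const (c := log 2)).add hint0).congr ?_
    intro t ht
    simp only
    rw [log_mul (by norm_num) (hsin t ht).ne']
  refine ⟨hint, ?_⟩
  have hL : Tendsto (fun r : ℝ => ∫ t in a..b, -(1/2) * log ((1-r)^2 + 4*r*(sin t)^2)) (𝓝[<] 1)
      (𝓝 (∫ t in a..b, -(1/2) * log ((1-1)^2 + 4*1*(sin t)^2))) := by
    have hev : ∀ᶠ r : ℝ in 𝓝[<] 1, 1/2 < r ∧ r < 1 := 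
      Ioo_mem_nhdsLT (by norm_num)
    apply intervalIntegral.tendsto_integral_filter_of_dominated_convergence (fun t => log 2 + |log (sin t)|)
    · refine Eventually.of_forall fun r => ?_
      apply Measurable.aestronglyMeasurable
      fun_prop
    · filter_upwards [hev] with r hr
      refine Eventually.of_forall fun t ht => ?_
      have hs := hsin t ht
      have hs1 := sin_le_one t
      have e1 : (sin t)^2 ≤ (1-r)^2 + 4*r*(sin t)^2 := by nlinarith [sq_nonneg (1-r), sq_nonneg (sin t)]
      have e2 : (1-r)^2 + 4*r*(sin t)^2 ≤ 2^2 := by nlinarith [sq_nonneg (1-r), sq_nonneg (sin t)]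
      have l1 := log_le_log (by positivity) e1
      have l2 := log_le_log (lt_of_lt_of_le (by positivity) e1) e2
      rw [log_pow] at l1 l2
      push_cast at l1 l2
      have := neg_abs_le (log (sin t))
      have := log_pos (one_lt_two)
      rw [norm_eq_abs, abs_le]
      constructor <;> linarith [abs_nonneg (log (sin t))]
    · exact intervalIntegrable_const.add hint0.abs
    · refine Eventually.of_forall fun t ht => ?_
      have hs := hsin t ht
      have : ContinuousAt (fun r : ℝ => -(1/2) * log ((1-r)^2 + 4*r*(sin t)^2)) 1 := by
        apply ContinuousAt.mul continuousAt_const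
        apply ContinuousAt.log (by fun_prop)
        positivity
      exact this.tendsto.mono_left nhdsWithin_le_nhds
  have hS := ((sumCl (2*b)).sub (sumCl (2*a))).mul_left (1/2)
  have hR : Tendsto (fun r : ℝ => ∑' n : ℕ, r^(n+1) * ((1/2) * (sin (((n:ℝ)+1) * (2*b)) / ((n:ℝ)+1)^2 - sin (((n:ℝ)+1) * (2*a)) / ((n:ℝ)+1)^2))) (𝓝[<] 1)
     (𝓝 (∑' n : ℕ, ((1/2) * (sin (((n:ℝ)+1) * (2*b)) / ((n:ℝ)+1)^2 - sin (((n:ℝ)+1) * (2*a)) / ((n:ℝ)+1)^2)))) := by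
    apply tendsto_tsum_of_dominated_convergence hS.norm
    · intro n
      have : Continuous (fun r : ℝ => r^(n+1) * ((1/2) * (sin (((n:ℝ)+1) * (2*b)) / ((n:ℝ)+1)^2 - sin (((n:ℝ)+1) * (2*a)) / ((n:ℝ)+1)^2))) := by fun_prop
      have := (this.tendsto 1).mono_left (nhdsWithin_le_nhds (s := Set.Iio 1))
      simpa using this
    · filter_upwards [Ioo_mem_nhdsLT (show (0:ℝ) < 1 by norm_num)] with r hr n
      rw [norm_mul]
      apply mul_le_of_le_one_left (norm_nonneg _)
      rw [norm_of_nonneg (by have := hr.1; positivity)]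
      exact pow_le_one₀ hr.1.le hr.2.le
  have heq := tendsto_nhds_unique (hL.congr' (by
    filter_upwards [Ioo_mem_nhdsLT (show (0:ℝ) < 1 by norm_num)] with r hr
    exact intR r a b hr.1.le hr.2)) hR
  rw [tsum_mul_left, (sumCl (2*b)).tsum_sub (sumCl (2*a))] at heq
  have e : ∫ t in a..b, log (2 * sin t) = - ∫ t in a..b, -(1/2) * log ((1-1)^2 + 4*1*(sin t)^2) := by
    rw [← intervalIntegral.integral_neg]
    apply intervalIntegral.integral_congr
    intro t ht
    simp only
    rw [show (1-1)^2 + 4*1*(sin t)^2 = (2 * sin t)^2 by ring, log_pow]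
    push_cast; ring
  rw [e, heq]; unfold Cl; ring

lemma polarMem (α β r θ : ℝ) (hα : 0 < α) (hαβ : α ≤ β) (hβ : β < π / 2) (hr : 0 < r)
    (hθ : θ ∈ Set.Ioo (-π) π) :
    (0 < r * cos θ ∧ r * cos θ < cos β ∧ 0 < r * sin θ ∧ r * sin θ < r * cos θ * tan α) ↔
      (θ ∈ Set.Ioo 0 α ∧ r ∈ Set.Ioo 0 (cos β / cos θ)) := by
  constructor
  · rintro ⟨h1, h2, h3, h4⟩
    have c : 0 < cos θ := pos_of_mul_pos_right h1 hr.le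
    have s : 0 < sin θ := pos_of_mul_pos_right h3 hr.le
    have p : 0 < θ := by
      by_contra h
      exact absurd s (not_lt.2 (sin_nonpos_of_nonpos_of_neg_pi_le (not_lt.1 h) hθ.1.le))
    have q : θ < π/2 := by
      by_contra h
      exact absurd c (not_lt.2 (cos_nonpos_of_pi_div_two_le_of_le (not_lt.1 h) (by linarith [hθ.2])))
    have ht : tan θ < tan α := by
      rw [tan_eq_sin_div_cos θ, div_lt_iff₀ c]
      rw [mul_assoc] at h4
      have := lt_of_mul_lt_mul_left h4 hr.le
      linarith
    refine ⟨⟨p, ?_⟩, hr, (lt_div_iff₀ c).2 h2⟩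
    by_contra h
    have := strictMonoOn_tan.monotoneOn (show α ∈ Set.Ioo (-(π/2)) (π/2) from ⟨by linarith, by linarith⟩)
      (show θ ∈ Set.Ioo (-(π/2)) (π/2) from ⟨by linarith, q⟩) (not_lt.1 h)
    linarith
  · rintro ⟨⟨h1, h2⟩, h3, h4⟩
    have c : 0 < cos θ := cos_pos_of_mem_Ioo ⟨by linarith, by linarith⟩
    have s : 0 < sin θ := sin_pos_of_pos_of_lt_pi h1 hθ.2
    refine ⟨by positivity, (lt_div_iff₀ c).1 h4, by positivity, ?_⟩
    rw [mul_assoc]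
    apply mul_lt_mul_of_pos_left _ hr
    have := strictMonoOn_tan (show θ ∈ Set.Ioo (-(π/2)) (π/2) from ⟨by linarith, by linarith⟩)
      (show α ∈ Set.Ioo (-(π/2)) (π/2) from ⟨by linarith, by linarith⟩) h2
    rw [tan_eq_sin_div_cos θ, div_lt_iff₀ c] at this
    linarith

lemma inner_int (R : ℝ) (h0 : 0 ≤ R) (h1 : R < 1) :
    ∫⁻ r in Set.Ioo 0 R, ENNReal.ofReal (r / (2 * (1 - r^2))) = ENNReal.ofReal (-(1/4) * log (1 - R^2)) := by
  have hpos : ∀ r ∈ Set.Icc 0 R, 0 < 1 - r^2 := by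
    intro r hr; nlinarith [hr.1, hr.2]
  have hc : ContinuousOn (fun r : ℝ => r / (2 * (1 - r^2))) (Set.Icc 0 R) := by
    apply ContinuousOn.div (by fun_prop) (by fun_prop)
    intro r hr; have := hpos r hr; positivity
  have hi : IntegrableOn (fun r : ℝ => r / (2 * (1 - r^2))) (Set.Ioo 0 R) :=
    (hc.integrableOn_Icc).mono_set Set.Ioo_subset_Icc_self
  rw [← ofReal_integral_eq_lintegral_ofReal hi]
  · rw [← integral_Ioc_eq_integral_Ioo, ← intervalIntegral.integral_of_le h0,
      intervalIntegral.integral_eq_sub_of_hasDerivAt (f := fun r => -(1/4) * log (1 - r^2))]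
    · simp
    · intro r hr
      rw [Set.uIcc_of_le h0] at hr
      have := hpos r hr
      have h := (((hasDerivAt_pow 2 r).const_sub 1).log this.ne').const_mul (-(1/4))
      refine h.congr_deriv ?_
      field_simp
      norm_num
      ring
    · apply ContinuousOn.intervalIntegrable
      rwa [Set.uIcc_of_le h0]
  · filter_upwards [ae_restrict_mem measurableSet_Ioo] with r hr
    have := hpos r ⟨hr.1.le, hr.2.le⟩
    have := hr.1
    simp only [Pi.zero_apply]
    positivity

lemma lint (α β : ℝ) (hα : 0 < α) (hαβ : α ≤ β) (hβ : β < π / 2) :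
    ∫⁻ p in {p : ℝ × ℝ | 0 < p.1 ∧ p.1 < cos β ∧ 0 < p.2 ∧ p.2 < p.1 * tan α},
      ENNReal.ofReal (1 / (2 * (1 - p.1 ^ 2 - p.2 ^ 2))) =
    ∫⁻ θ in Set.Ioo 0 α, ENNReal.ofReal (-(1/4) * log (1 - (cos β / cos θ)^2)) := by
  have hS : MeasurableSet {p : ℝ × ℝ | 0 < p.1 ∧ p.1 < cos β ∧ 0 < p.2 ∧ p.2 < p.1 * tan α} := by
    simp only [Set.ofPred_and]
    refine MeasurableSet.inter ?_ (MeasurableSet.inter ?_ (MeasurableSet.inter ?_ ?_)) <;> apply measurableSet_lt <;> fun_prop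
  set T : Set (ℝ × ℝ) := {p | p.2 ∈ Set.Ioo 0 α ∧ p.1 ∈ Set.Ioo 0 (cos β / cos p.2)} with hT
  have hTm : MeasurableSet T := by
    simp only [hT, Set.mem_Ioo, Set.ofPred_and]
    refine MeasurableSet.inter (MeasurableSet.inter ?_ ?_) (MeasurableSet.inter ?_ ?_) <;> apply measurableSet_lt <;> fun_prop
  rw [← lintegral_indicator hS, ← lintegral_comp_polarCoord_symm]
  have htm : MeasurableSet polarCoord.target := polarCoord.open_target.measurableSet
  rw [← lintegral_indicator htm]
  have e : ∀ p : ℝ × ℝ, polarCoord.target.indicator (fun p : ℝ × ℝ => ENNReal.ofReal p.1 • ({p : ℝ × ℝ | 0 < p.1 ∧ p.1 < cos β ∧ 0 < p.2 ∧ p.2 < p.1 * tan α}.indicator (fun p : ℝ × ℝ => ENNReal.ofReal (1 / (2 * (1 - p.1 ^ 2 - p.2 ^ 2)))) (polarCoord.symm p))) p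
      = T.indicator (fun p : ℝ × ℝ => ENNReal.ofReal (p.1 / (2 * (1 - p.1^2)))) p := by
    rintro ⟨r, θ⟩
    by_cases hp : (r, θ) ∈ polarCoord.target
    · rw [Set.indicator_of_mem hp]
      have hp' := hp
      rw [polarCoord_target] at hp'
      obtain ⟨hr, hθ⟩ := hp'
      have hm := polarMem α β r θ hα hαβ hβ hr hθ
      by_cases hq : (r, θ) ∈ T
      · rw [Set.indicator_of_mem hq, Set.indicator_of_mem (by exact hm.2 hq)]
        simp only [polarCoord_symm_apply, smul_eq_mul]
        rw [← ENNReal.ofReal_mul (le_of_lt hr)]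
        congr 1
        have : 1 - (r * cos θ)^2 - (r * sin θ)^2 = 1 - r^2 := by
          linear_combination (-r^2) * sin_sq_add_cos_sq θ
        rw [this]; ring
      · rw [Set.indicator_of_notMem hq, Set.indicator_of_notMem (by exact fun h => hq (hm.1 h))]
        simp
    · rw [Set.indicator_of_notMem hp, Set.indicator_of_notMem]
      rintro ⟨h1, h2⟩
      apply hp
      rw [polarCoord_target]
      simp only [Set.mem_Ioo] at h1 h2
      exact ⟨h2.1, by simp only; linarith, by simp only; linarith⟩
  rw [lintegral_congr e, Measure.volume_eq_prod, lintegral_prod_symm _ (by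
    apply Measurable.aemeasurable
    apply Measurable.indicator _ hTm
    fun_prop), ← lintegral_indicator measurableSet_Ioo]
  apply lintegral_congr
  intro θ
  by_cases hθ : θ ∈ Set.Ioo 0 α
  · rw [Set.indicator_of_mem hθ]
    have cb : 0 < cos β := cos_pos_of_mem_Ioo ⟨by linarith, by linarith⟩
    have cc : cos β < cos θ := cos_lt_cos_of_nonneg_of_le_pi hθ.1.le (by linarith) (by linarith [hθ.2])
    rw [← inner_int (cos β / cos θ) (div_nonneg cb.le (by linarith)) ((div_lt_one (by linarith)).2 cc), ← lintegral_indicator measurableSet_Ioo]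
    apply lintegral_congr
    intro r
    by_cases h : r ∈ Set.Ioo 0 (cos β / cos θ)
    · rw [Set.indicator_of_mem h, Set.indicator_of_mem (by exact ⟨hθ, h⟩)]
    · rw [Set.indicator_of_notMem h, Set.indicator_of_notMem (by exact fun k => h k.2)]
  · rw [Set.indicator_of_notMem hθ]
    rw [← lintegral_zero (μ := (volume : Measure ℝ))]
    apply lintegral_congr
    intro r
    rw [Set.indicator_of_notMem (by exact fun k => hθ k.1)]

lemma Cl_neg (x : ℝ) : Cl (-x) = - Cl x := by
  unfold Cl
  rw [← tsum_neg]
  congr 1; ext n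
  rw [mul_neg, sin_neg, neg_div]

lemma Cl_pi : Cl π = 0 := by
  unfold Cl
  rw [← tsum_zero (α := ℝ) (β := ℕ)]
  congr 1; ext n
  have := sin_nat_mul_pi (n+1)
  push_cast at this
  rw [this, zero_div]

lemma outer (α β : ℝ) (hα : 0 < α) (hαβ : α ≤ β) (hβ : β < π / 2) :
    IntervalIntegrable (fun θ => -(1/4) * (log (2 * sin (β - θ)) + log (2 * sin (β + θ)) - 2 * log (2 * sin (π/2 - θ)))) volume 0 α ∧
    ∫ θ in (0:ℝ)..α, -(1/4) * (log (2 * sin (β - θ)) + log (2 * sin (β + θ)) - 2 * log (2 * sin (π/2 - θ))) =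
      (1 / 8) * (2 * Cl (π - 2 * α) + Cl (2 * α - 2 * β) + Cl (2 * α + 2 * β)) := by
  obtain ⟨i1, v1⟩ := keyLem (β - α) β (by linarith) (by linarith) (by linarith)
  obtain ⟨i2, v2⟩ := keyLem β (β + α) (by linarith) (by linarith) (by linarith)
  obtain ⟨i3, v3⟩ := keyLem (π/2 - α) (π/2) (by linarith) (by linarith) (by linarith)
  have j1 : IntervalIntegrable (fun θ => log (2 * sin (β - θ))) volume 0 α := by
    simpa using (i1.comp_sub_left β).symm
  have j2 : IntervalIntegrable (fun θ => log (2 * sin (β + θ))) volume 0 α := by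
    simpa using (i2.comp_add_left β)
  have j3 : IntervalIntegrable (fun θ => log (2 * sin (π/2 - θ))) volume 0 α := by
    simpa using (i3.comp_sub_left (π/2)).symm
  have j12 : IntervalIntegrable (fun θ => log (2 * sin (β - θ)) + log (2 * sin (β + θ))) volume 0 α := j1.add j2
  refine ⟨(j12.sub (j3.const_mul 2)).const_mul _, ?_⟩
  rw [intervalIntegral.integral_const_mul, intervalIntegral.integral_sub j12 (j3.const_mul 2),
    intervalIntegral.integral_add j1 j2, intervalIntegral.integral_const_mul,
    intervalIntegral.integral_comp_sub_left (fun t => log (2 * sin t)) β,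
    intervalIntegral.integral_comp_sub_left (fun t => log (2 * sin t)) (π/2),
    intervalIntegral.integral_comp_add_left (fun t => log (2 * sin t)) β]
  simp only [sub_zero, add_zero]
  rw [v1, v2, v3, show 2 * (π/2) = π by ring, Cl_pi, show 2 * α - 2 * β = - (2 * (β - α)) by ring, Cl_neg,
    show 2 * (π/2 - α) = π - 2 * α by ring, show 2 * (β + α) = 2 * α + 2 * β by ring]
  ring

lemma Geq (α β θ : ℝ) (hαβ : α ≤ β) (hβ : β < π / 2) (hθ : θ ∈ Set.Ioo 0 α) :
    -(1/4) * log (1 - (cos β / cos θ)^2) = -(1/4) * (log (2 * sin (β - θ)) + log (2 * sin (β + θ)) - 2 * log (2 * sin (π/2 - θ))) ∧ 0 ≤ -(1/4) * log (1 - (cos β / cos θ)^2) := by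
  obtain ⟨h1, h2⟩ := hθ
  have c : 0 < cos θ := cos_pos_of_mem_Ioo ⟨by linarith, by linarith⟩
  have s1 : 0 < sin (β - θ) := sin_pos_of_pos_of_lt_pi (by linarith) (by linarith)
  have s2 : 0 < sin (β + θ) := sin_pos_of_pos_of_lt_pi (by linarith) (by linarith)
  have e : 1 - (cos β / cos θ)^2 = (2 * sin (β - θ)) * (2 * sin (β + θ)) / (2 * cos θ)^2 := by
    rw [sin_sub, sin_add]
    field_simp
    have a := sin_sq_add_cos_sq θ
    have b := sin_sq_add_cos_sq β
    linear_combination (-cos θ^2) * b + (cos β)^2 * a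
  constructor
  · rw [sin_pi_div_two_sub, e, log_div (by positivity) (by positivity), log_mul (by positivity) (by positivity), log_pow]
    push_cast; ring
  · have : log (1 - (cos β / cos θ)^2) ≤ 0 := by
      apply log_nonpos
      · rw [e]; positivity
      · nlinarith [sq_nonneg (cos β / cos θ)]
    linarith

/-- The volume of a triply orthogonal hyperbolic tetrahedron with one vertex at infinity,
computed in the upper half-space model: for `0 < α ≤ β < π/2`,
`∫∫_{0<x<cos β, 0<y<x tan α} dy dx / (2(1−x²−y²))
  = (1/8)(2 Cl(π−2α) + Cl(2α−2β) + Cl(2α+2β))`, and the integral converges. -/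
theorem orthoscheme_volume (α β : ℝ) (hα : 0 < α) (hαβ : α ≤ β) (hβ : β < Real.pi / 2) :
    IntegrableOn (fun p : ℝ × ℝ => 1 / (2 * (1 - p.1 ^ 2 - p.2 ^ 2)))
      {p : ℝ × ℝ | 0 < p.1 ∧ p.1 < Real.cos β ∧ 0 < p.2 ∧ p.2 < p.1 * Real.tan α}
      volume ∧
    (∫ p in {p : ℝ × ℝ | 0 < p.1 ∧ p.1 < Real.cos β ∧ 0 < p.2 ∧ p.2 < p.1 * Real.tan α},
        1 / (2 * (1 - p.1 ^ 2 - p.2 ^ 2))) =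
      (1 / 8) * (2 * Cl (Real.pi - 2 * α) + Cl (2 * α - 2 * β) + Cl (2 * α + 2 * β)) := by
  obtain ⟨hi, hv⟩ := outer α β hα hαβ hβ
  have hl := lint α β hα hαβ hβ
  have hi' := (intervalIntegrable_iff_integrableOn_Ioo_of_le hα.le).1 hi
  rw [setLIntegral_congr_fun measurableSet_Ioo (fun θ hθ => by rw [(Geq α β θ hαβ hβ hθ).1]),
    ← ofReal_integral_eq_lintegral_ofReal hi' (by
      filter_upwards [ae_restrict_mem measurableSet_Ioo] with θ hθ
      have := Geq α β θ hαβ hβ hθ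
      rw [← this.1]; exact this.2), ← integral_Ioc_eq_integral_Ioo,
    ← intervalIntegral.integral_of_le hα.le] at hl
  have hnn0 : 0 ≤ ∫ θ in (0:ℝ)..α, -(1/4) * (log (2 * sin (β - θ)) + log (2 * sin (β + θ)) - 2 * log (2 * sin (π/2 - θ))) := by
    rw [intervalIntegral.integral_of_le hα.le, integral_Ioc_eq_integral_Ioo]
    apply setIntegral_nonneg measurableSet_Ioo
    intro θ hθ
    have := Geq α β θ hαβ hβ hθ
    rw [← this.1]; exact this.2
  rw [hv] at hl hnn0
  have hS : MeasurableSet {p : ℝ × ℝ | 0 < p.1 ∧ p.1 < cos β ∧ 0 < p.2 ∧ p.2 < p.1 * tan α} := by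
    simp only [Set.ofPred_and]
    refine MeasurableSet.inter ?_ (MeasurableSet.inter ?_ (MeasurableSet.inter ?_ ?_)) <;> apply measurableSet_lt <;> fun_prop
  have ca : 0 < cos α := cos_pos_of_mem_Ioo ⟨by linarith, by linarith⟩
  have cba : cos β ≤ cos α := cos_le_cos_of_nonneg_of_le_pi hα.le (by linarith) hαβ
  have hpos : ∀ p ∈ {p : ℝ × ℝ | 0 < p.1 ∧ p.1 < cos β ∧ 0 < p.2 ∧ p.2 < p.1 * tan α},
      0 ≤ 1 / (2 * (1 - p.1 ^ 2 - p.2 ^ 2)) := by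
    rintro ⟨x, y⟩ ⟨h1, h2, h3, h4⟩
    simp only at *
    rw [tan_eq_sin_div_cos, ← mul_div_assoc, lt_div_iff₀ ca] at h4
    have a := sin_sq_add_cos_sq α
    have b1 : (y * cos α)^2 ≤ (x * sin α)^2 := by
      apply pow_le_pow_left₀ (by positivity) h4.le
    have b2 : x^2 ≤ cos α^2 := pow_le_pow_left₀ h1.le (by linarith) 2
    have b3 : (x^2 + y^2) * cos α^2 ≤ 1 * cos α^2 := by
      calc (x^2 + y^2) * cos α^2 ≤ x^2 * (sin α^2 + cos α^2) := by nlinarith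
        _ ≤ _ := by rw [a]; linarith
    have b4 := le_of_mul_le_mul_right b3 (by positivity)
    apply div_nonneg zero_le_one
    linarith
  have hm : Measurable (fun p : ℝ × ℝ => 1 / (2 * (1 - p.1 ^ 2 - p.2 ^ 2))) := by fun_prop
  have hae : 0 ≤ᵐ[volume.restrict {p : ℝ × ℝ | 0 < p.1 ∧ p.1 < cos β ∧ 0 < p.2 ∧ p.2 < p.1 * tan α}] (fun p : ℝ × ℝ => 1 / (2 * (1 - p.1 ^ 2 - p.2 ^ 2))) := by
    filter_upwards [ae_restrict_mem hS] with p hp using hpos p hp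
  constructor
  · refine ⟨hm.aestronglyMeasurable, ?_⟩
    rw [hasFiniteIntegral_iff_ofReal hae, hl]
    exact ENNReal.ofReal_lt_top
  · rw [integral_eq_lintegral_of_nonneg_ae hae hm.aestronglyMeasurable, hl, ENNReal.toReal_ofReal hnn0]
end
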